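/- Suppose δ < (d−1)/(d+1), β < 2δ/(d(d−1)) + (d−2)/d, and p_n → 1 as n → ∞. Let Ĥ(A) = { Ψ ⊆ [n] : |Ψ| = d and every pair of distinct vertices of Ψ is an edge of A } be the clique estimator. Then, with (H,A) ∼ ℙ, E[ |Ĥ(A) △ H| ] / ( s_n·C(n,d) ) → 0 as n → ∞; i.e., the clique estimator achieves almost-exact reconstruction. -/

import Mathlib

open Finset Filter
open scoped Classical symmDiff

noncomputable section

namespace NoisyHypergraph

/-- The set of unordered pairs of distinct vertices of `[n]`, encoded as 2-element subsets. -/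
def pairs (n : ℕ) : Finset (Finset (Fin n)) :=
  (Finset.univ : Finset (Fin n)).powersetCard 2

/-- The set of `d`-element subsets of `[n]` (potential hyperedges). -/
def dsets (n d : ℕ) : Finset (Finset (Fin n)) :=
  (Finset.univ : Finset (Fin n)).powersetCard d

/-- Projection of a hypergraph: all pairs of distinct vertices contained in some hyperedge. -/
def proj (n : ℕ) (H : Finset (Finset (Fin n))) : Finset (Finset (Fin n)) :=
  (pairs n).filter fun e => ∃ Ψ ∈ H, e ⊆ Ψ

/-- Mass function of `μ_{n,d,s}`: each `d`-subset included independently with probability `s`. -/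
def mu (n d : ℕ) (s : ℝ) (H : Finset (Finset (Fin n))) : ℝ :=
  s ^ H.card * (1 - s) ^ ((dsets n d).card - H.card)

/-- Conditional mass function of the noisy projection `A` given the hypergraph `H`:
edges of `P(H)` kept with probability `p`, other pairs added with probability `q`. -/
def condP (n : ℕ) (p q : ℝ) (H A : Finset (Finset (Fin n))) : ℝ :=
  p ^ (A ∩ proj n H).card * (1 - p) ^ (proj n H \ A).card *
    q ^ (A \ proj n H).card * (1 - q) ^ ((pairs n \ proj n H) \ A).card

/-- Erdős–Rényi `G(n,q)` mass function. -/
def er (n : ℕ) (q : ℝ) (A : Finset (Finset (Fin n))) : ℝ :=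
  q ^ A.card * (1 - q) ^ ((pairs n).card - A.card)

/-- Joint planted mass function of `(H, A)` under `ℙ`. -/
def joint (n d : ℕ) (s p q : ℝ) (H A : Finset (Finset (Fin n))) : ℝ :=
  mu n d s H * condP n p q H A

/-- Marginal law of `A` under the planted measure `ℙ`. -/
def marg (n d : ℕ) (s p q : ℝ) (A : Finset (Finset (Fin n))) : ℝ :=
  ∑ H ∈ (dsets n d).powerset, joint n d s p q H A

/-- Probability of an event under the joint planted law `ℙ`. -/
def prJoint (n d : ℕ) (s p q : ℝ)
    (E : Finset (Finset (Fin n)) → Finset (Finset (Fin n)) → Prop) : ℝ :=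
  ∑ H ∈ (dsets n d).powerset, ∑ A ∈ (pairs n).powerset,
    if E H A then joint n d s p q H A else 0

/-- Probability of an event under the Erdős–Rényi law. -/
def prER (n : ℕ) (q : ℝ) (E : Finset (Finset (Fin n)) → Prop) : ℝ :=
  ∑ A ∈ (pairs n).powerset, if E A then er n q A else 0

/-- The clique estimator `Ĥ(A)`: all `d`-subsets of `[n]` that form a clique in `A`. -/
def cliqueEst (n d : ℕ) (A : Finset (Finset (Fin n))) : Finset (Finset (Fin n)) :=
  (dsets n d).filter fun Ψ => ∀ e ∈ pairs n, e ⊆ Ψ → e ∈ A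


/-- Conditional edge probability of the pair `e` given `H`. -/
def edgeProb (n : ℕ) (p q : ℝ) (H : Finset (Finset (Fin n))) (e : Finset (Fin n)) : ℝ :=
  if e ∈ proj n H then p else q

lemma proj_subset (n : ℕ) (H : Finset (Finset (Fin n))) : proj n H ⊆ pairs n :=
  Finset.filter_subset _ _

lemma condP_eq (n : ℕ) (p q : ℝ) (H A : Finset (Finset (Fin n))) :
    condP n p q H A = (∏ e ∈ A, edgeProb n p q H e) *
      ∏ e ∈ pairs n \ A, (1 - edgeProb n p q H e) := by
  have h1 : ∏ e ∈ A, edgeProb n p q H e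
      = p ^ (A ∩ proj n H).card * q ^ (A \ proj n H).card := by
    unfold edgeProb
    rw [Finset.prod_ite, Finset.prod_const, Finset.prod_const, Finset.filter_mem_eq_inter,
      Finset.filter_notMem_eq_sdiff]
  have h2 : ∏ e ∈ pairs n \ A, (1 - edgeProb n p q H e)
      = (1 - p) ^ (proj n H \ A).card * (1 - q) ^ ((pairs n \ proj n H) \ A).card := by
    have : ∀ e, 1 - edgeProb n p q H e = if e ∈ proj n H then 1 - p else 1 - q := by
      intro e; unfold edgeProb; split_ifs <;> rfl
    simp_rw [this]
    rw [Finset.prod_ite, Finset.prod_const, Finset.prod_const, Finset.filter_mem_eq_inter,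
      Finset.filter_notMem_eq_sdiff]
    have e1 : (pairs n \ A) ∩ proj n H = proj n H \ A := by
      ext e
      have := @proj_subset n H e
      simp only [Finset.mem_inter, Finset.mem_sdiff]; tauto
    have e2 : (pairs n \ A) \ proj n H = (pairs n \ proj n H) \ A := by
      ext e
      simp only [Finset.mem_sdiff]; tauto
    rw [e1, e2]
  rw [h1, h2, condP]; ring

lemma sum_condP_clique (n : ℕ) (p q : ℝ) (H K : Finset (Finset (Fin n))) (hK : K ⊆ pairs n) :
    ∑ A ∈ (pairs n).powerset, condP n p q H A * (if K ⊆ A then 1 else 0)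
      = ∏ e ∈ K, edgeProb n p q H e := by
  have h := Finset.prod_add (edgeProb n p q H)
    (fun e => if e ∈ K then 0 else 1 - edgeProb n p q H e) (pairs n)
  have h3 : ∏ e ∈ pairs n, (edgeProb n p q H e
      + (if e ∈ K then 0 else 1 - edgeProb n p q H e)) = ∏ e ∈ K, edgeProb n p q H e := by
    rw [← Finset.prod_subset hK]
    · exact Finset.prod_congr rfl fun e he => by simp [he]
    · intro e _ he; simp [he]
  rw [← h3, h]
  refine Finset.sum_congr rfl fun A hA => ?_
  by_cases hKA : K ⊆ A
  · rw [if_pos hKA, mul_one, condP_eq]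
    congr 1
    refine Finset.prod_congr rfl fun e he => ?_
    rw [if_neg]
    intro h'
    exact (Finset.mem_sdiff.1 he).2 (hKA h')
  · rw [if_neg hKA, mul_zero]
    obtain ⟨e, he, heA⟩ := Finset.not_subset.1 hKA
    rw [Finset.prod_eq_zero (i := e) (Finset.mem_sdiff.2 ⟨hK he, heA⟩) (by simp [he]), mul_zero]

lemma sum_condP (n : ℕ) (p q : ℝ) (H : Finset (Finset (Fin n))) :
    ∑ A ∈ (pairs n).powerset, condP n p q H A = 1 := by
  have := sum_condP_clique n p q H ∅ (by simp)
  simpa using this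

lemma sum_mu_prod (n d : ℕ) (s : ℝ) (w : Finset (Fin n) → ℝ) :
    ∑ H ∈ (dsets n d).powerset, mu n d s H * ∏ Φ ∈ H, w Φ
      = ∏ Φ ∈ dsets n d, (s * w Φ + (1 - s)) := by
  rw [Finset.prod_add]
  refine Finset.sum_congr rfl fun H hH => ?_
  rw [Finset.prod_mul_distrib, Finset.prod_const, Finset.prod_const,
    Finset.card_sdiff_of_subset (Finset.mem_powerset.1 hH), mu]
  ring

lemma mu_nonneg (n d : ℕ) (s : ℝ) (h0 : 0 ≤ s) (h1 : s ≤ 1) (H : Finset (Finset (Fin n))) :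
    0 ≤ mu n d s H :=
  mul_nonneg (pow_nonneg h0 _) (pow_nonneg (by linarith) _)

/-- the probability that a given hyperedge is present -/
lemma sum_mu_mem (n d : ℕ) (s : ℝ) (Ψ : Finset (Fin n)) (hΨ : Ψ ∈ dsets n d) :
    ∑ H ∈ (dsets n d).powerset, mu n d s H * (if Ψ ∈ H then 1 else 0) = s := by
  have h1 := sum_mu_prod n d s (fun _ => 1)
  have h0 := sum_mu_prod n d s (fun Φ => if Φ = Ψ then 0 else 1)
  have e1 : ∏ Φ ∈ dsets n d, (s * (1 : ℝ) + (1 - s)) = 1 :=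
    Finset.prod_eq_one fun _ _ => by ring
  have e0 : ∏ Φ ∈ dsets n d, (s * (if Φ = Ψ then (0 : ℝ) else 1) + (1 - s)) = 1 - s := by
    rw [Finset.prod_eq_single Ψ]
    · simp
    · intro b _ hb; simp [hb]
    · intro h; exact absurd hΨ h
  rw [e1] at h1
  rw [e0] at h0
  have : ∀ H : Finset (Finset (Fin n)), mu n d s H * (if Ψ ∈ H then 1 else 0)
      = mu n d s H * ∏ Φ ∈ H, (1 : ℝ) - mu n d s H * ∏ Φ ∈ H, (if Φ = Ψ then (0 : ℝ) else 1) := by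
    intro H
    by_cases h : Ψ ∈ H
    · have : ∏ Φ ∈ H, (if Φ = Ψ then (0 : ℝ) else 1) = 0 :=
        Finset.prod_eq_zero h (if_pos rfl)
      rw [this]; simp [h]
    · have : ∏ Φ ∈ H, (if Φ = Ψ then (0 : ℝ) else 1) = 1 :=
        Finset.prod_eq_one fun Φ hΦ => by
          rw [if_neg]; rintro rfl; exact h hΦ
      rw [this]; simp [h]
  simp_rw [this]
  rw [Finset.sum_sub_distrib, h1, h0]; ring

lemma mem_cliqueEst (n d : ℕ) (A : Finset (Finset (Fin n))) (Ψ : Finset (Fin n))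
    (hΨ : Ψ ∈ dsets n d) : Ψ ∈ cliqueEst n d A ↔ Ψ.powersetCard 2 ⊆ A := by
  unfold cliqueEst
  rw [Finset.mem_filter]
  constructor
  · rintro ⟨_, h⟩ e he
    rw [Finset.mem_powersetCard] at he
    exact h e (by simp [pairs, he.2]) he.1
  · intro h
    refine ⟨hΨ, fun e he hs => h ?_⟩
    rw [Finset.mem_powersetCard]
    exact ⟨hs, by simpa [pairs] using he⟩

lemma powersetCard_subset_pairs (n : ℕ) (Ψ : Finset (Fin n)) : Ψ.powersetCard 2 ⊆ pairs n :=
  Finset.powersetCard_mono (Finset.subset_univ _)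

lemma card_err (n d : ℕ) (H A : Finset (Finset (Fin n))) (hH : H ⊆ dsets n d) :
    ((cliqueEst n d A ∆ H).card : ℝ) = ∑ Ψ ∈ dsets n d,
      ((if Ψ ∈ H then 1 else 0) + (1 - 2 * (if Ψ ∈ H then 1 else 0)) *
        (if Ψ.powersetCard 2 ⊆ A then 1 else 0)) := by
  have hsub : cliqueEst n d A ∆ H ⊆ dsets n d := by
    intro Ψ hΨ
    rcases Finset.mem_symmDiff.1 hΨ with h | h
    · exact (Finset.mem_filter.1 h.1).1
    · exact hH h.1
  have : ((cliqueEst n d A ∆ H).card : ℝ)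
      = ∑ Ψ ∈ dsets n d, if Ψ ∈ cliqueEst n d A ∆ H then (1 : ℝ) else 0 := by
    rw [Finset.sum_ite_mem, Finset.inter_eq_right.2 hsub]; simp
  rw [this]
  refine Finset.sum_congr rfl fun Ψ hΨ => ?_
  simp only [Finset.mem_symmDiff, mem_cliqueEst n d A Ψ hΨ]
  by_cases h1 : Ψ ∈ H <;> by_cases h2 : Ψ.powersetCard 2 ⊆ A <;> simp [h1, h2] <;> norm_num

lemma expected_eq (n d : ℕ) (s p q : ℝ) :
    ∑ H ∈ (dsets n d).powerset, ∑ A ∈ (pairs n).powerset,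
      joint n d s p q H A * ((cliqueEst n d A ∆ H).card : ℝ)
    = ∑ Ψ ∈ dsets n d, ∑ H ∈ (dsets n d).powerset, mu n d s H *
      ((if Ψ ∈ H then 1 else 0) + (1 - 2 * (if Ψ ∈ H then 1 else 0)) *
        ∏ e ∈ Ψ.powersetCard 2, edgeProb n p q H e) := by
  rw [Finset.sum_comm (s := dsets n d)]
  refine Finset.sum_congr rfl fun H hH => ?_
  rw [Finset.mem_powerset] at hH
  simp_rw [card_err n d H _ hH, Finset.mul_sum]
  rw [Finset.sum_comm]
  refine Finset.sum_congr rfl fun Ψ hΨ => ?_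
  rw [← sum_condP_clique n p q H _ (powersetCard_subset_pairs n Ψ)]
  have h1 := sum_condP n p q H
  set c : ℝ := if Ψ ∈ H then 1 else 0
  calc _ = ∑ A ∈ (pairs n).powerset, (mu n d s H * c * condP n p q H A +
        mu n d s H * (1 - 2 * c) * (condP n p q H A *
          (if Ψ.powersetCard 2 ⊆ A then 1 else 0))) := by
        refine Finset.sum_congr rfl fun A _ => ?_
        rw [joint]; ring
    _ = _ := by
        rw [Finset.sum_add_distrib, ← Finset.mul_sum, ← Finset.mul_sum, h1]; ring

lemma edgeProb_prod_le (n d : ℕ) (p q r : ℝ) (hp1 : p ≤ 1) (hp0 : 0 ≤ p)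
    (hq0 : 0 ≤ q) (hqr : q ≤ r) (hr : 0 < r) (hr1 : r ≤ 1)
    (H : Finset (Finset (Fin n))) (Ψ : Finset (Fin n)) (hΨ : Ψ.card = d) :
    ∏ e ∈ Ψ.powersetCard 2, edgeProb n p q H e
      ≤ r ^ (d.choose 2) * ∏ Φ ∈ H, r⁻¹ ^ ((Φ ∩ Ψ).card.choose 2) := by
  have hcov : ((Ψ.powersetCard 2) ∩ proj n H).card ≤ ∑ Φ ∈ H, (Φ ∩ Ψ).card.choose 2 := by
    calc _ ≤ (H.biUnion fun Φ => (Φ ∩ Ψ).powersetCard 2).card := by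
          refine Finset.card_le_card fun e he => ?_
          rw [Finset.mem_inter, Finset.mem_powersetCard, proj, Finset.mem_filter] at he
          obtain ⟨⟨h1, h2⟩, _, Φ, hΦ, h3⟩ := he
          rw [Finset.mem_biUnion]
          exact ⟨Φ, hΦ, Finset.mem_powersetCard.2 ⟨Finset.subset_inter h3 h1, h2⟩⟩
      _ ≤ ∑ Φ ∈ H, ((Φ ∩ Ψ).powersetCard 2).card := Finset.card_biUnion_le
      _ = _ := by simp [Finset.card_powersetCard]
  have hle : ∏ e ∈ Ψ.powersetCard 2, edgeProb n p q H e
      ≤ ∏ e ∈ Ψ.powersetCard 2, (r * if e ∈ proj n H then r⁻¹ else 1) := by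
    refine Finset.prod_le_prod (fun e _ => ?_) (fun e _ => ?_)
    · unfold edgeProb; split_ifs <;> assumption
    · unfold edgeProb; split_ifs
      · rwa [mul_inv_cancel₀ hr.ne']
      · simpa using hqr
  refine hle.trans ?_
  rw [Finset.prod_mul_distrib, Finset.prod_const, Finset.card_powersetCard, hΨ,
    Finset.prod_pow_eq_pow_sum, Finset.prod_ite, Finset.prod_const, Finset.prod_const_one,
    mul_one, Finset.filter_mem_eq_inter]
  exact mul_le_mul_of_nonneg_left (pow_le_pow_right₀ ((one_le_inv₀ hr).2 hr1) hcov)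
    (pow_nonneg hr.le _)

lemma card_inter_le (n d k : ℕ) (Ψ : Finset (Fin n)) (hΨ : Ψ.card = d) :
    ((dsets n d).filter fun Φ => (Φ ∩ Ψ).card = k).card ≤ d.choose k * n ^ (d - k) := by
  calc _ ≤ (Ψ.powersetCard k ×ˢ (Finset.univ : Finset (Fin n)).powersetCard (d - k)).card := by
        refine Finset.card_le_card_of_injOn (fun Φ => (Φ ∩ Ψ, Φ \ Ψ)) ?_ ?_
        · intro Φ hΦ
          simp only [Finset.coe_filter, Set.mem_ofPred_eq, dsets, Finset.mem_powersetCard] at hΦ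
          have := Finset.card_inter_add_card_sdiff Φ Ψ
          simp only [Finset.coe_product, Set.mem_prod, Finset.mem_coe, Finset.mem_powersetCard]
          refine ⟨⟨Finset.inter_subset_right, hΦ.2⟩, Finset.subset_univ _, by omega⟩
        · intro Φ _ Φ' _ h
          simp only [Prod.mk.injEq] at h
          rw [← Finset.sdiff_union_inter Φ Ψ, h.1, h.2, Finset.sdiff_union_inter]
    _ = d.choose k * n.choose (d - k) := by simp [Finset.card_product, hΨ]
    _ ≤ _ := Nat.mul_le_mul_left _ (Nat.choose_le_pow _ _)

lemma sum_false_pos_le (n d : ℕ) (s p q r : ℝ) (hs0 : 0 ≤ s) (hs1 : s ≤ 1)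
    (hp1 : p ≤ 1) (hp0 : 0 ≤ p)
    (hq0 : 0 ≤ q) (hqr : q ≤ r) (hr : 0 < r) (hr1 : r ≤ 1)
    (Ψ : Finset (Fin n)) (hΨ : Ψ ∈ dsets n d) :
    ∑ H ∈ (dsets n d).powerset, mu n d s H * (if Ψ ∈ H then 0 else
        ∏ e ∈ Ψ.powersetCard 2, edgeProb n p q H e)
      ≤ r ^ (d.choose 2) * Real.exp (∑ k ∈ Finset.Ico 2 d,
          (d.choose k : ℝ) * (s * (n : ℝ) ^ (d - k) * r⁻¹ ^ (k.choose 2))) := by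
  have hΨd : Ψ.card = d := (Finset.mem_powersetCard.1 hΨ).2
  have hR : 1 ≤ r⁻¹ := (one_le_inv₀ hr).2 hr1
  set w : Finset (Fin n) → ℝ :=
    fun Φ => if Φ = Ψ then 0 else r⁻¹ ^ ((Φ ∩ Ψ).card.choose 2) with hw
  have hw0 : ∀ Φ, 0 ≤ w Φ := by
    intro Φ; simp only [hw]; split_ifs <;> positivity
  have step1 : ∑ H ∈ (dsets n d).powerset, mu n d s H * (if Ψ ∈ H then 0 else
        ∏ e ∈ Ψ.powersetCard 2, edgeProb n p q H e)
      ≤ ∑ H ∈ (dsets n d).powerset, r ^ (d.choose 2) * (mu n d s H * ∏ Φ ∈ H, w Φ) := by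
    refine Finset.sum_le_sum fun H _ => ?_
    rw [mul_left_comm]
    refine mul_le_mul_of_nonneg_left ?_ (mu_nonneg n d s hs0 hs1 H)
    split_ifs with h
    · exact mul_nonneg (pow_nonneg hr.le _) (Finset.prod_nonneg fun Φ _ => hw0 Φ)
    · refine (edgeProb_prod_le n d p q r hp1 hp0 hq0 hqr hr hr1 H Ψ hΨd).trans (le_of_eq ?_)
      congr 1
      refine Finset.prod_congr rfl fun Φ hΦ => ?_
      simp only [hw]; rw [if_neg]; rintro rfl; exact h hΦ
  refine step1.trans ?_
  rw [← Finset.mul_sum, sum_mu_prod]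
  refine mul_le_mul_of_nonneg_left ?_ (pow_nonneg hr.le _)
  have step2 : ∏ Φ ∈ dsets n d, (s * w Φ + (1 - s))
      ≤ ∏ Φ ∈ dsets n d, Real.exp (s * (w Φ - 1)) := by
    refine Finset.prod_le_prod (fun Φ _ => ?_) (fun Φ _ => ?_)
    · exact add_nonneg (mul_nonneg hs0 (hw0 Φ)) (by linarith)
    · have := Real.add_one_le_exp (s * (w Φ - 1)); linarith
  refine step2.trans ?_
  rw [← Real.exp_sum, Real.exp_le_exp]
  set g : ℕ → ℝ := fun k => if 2 ≤ k ∧ k < d then s * r⁻¹ ^ (k.choose 2) else 0 with hg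
  have hg0 : ∀ k, 0 ≤ g k := by
    intro k; simp only [hg]; split_ifs <;> positivity
  have step3 : ∑ Φ ∈ dsets n d, s * (w Φ - 1) ≤ ∑ Φ ∈ dsets n d, g ((Φ ∩ Ψ).card) := by
    refine Finset.sum_le_sum fun Φ hΦ => ?_
    have hΦd : Φ.card = d := (Finset.mem_powersetCard.1 hΦ).2
    by_cases h : Φ = Ψ
    · refine le_trans ?_ (hg0 _)
      simp only [hw, if_pos h]; linarith
    · have hlt : (Φ ∩ Ψ).card < d := by
        rw [← hΦd]
        refine Finset.card_lt_card ⟨Finset.inter_subset_left, fun hc => h ?_⟩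
        exact Finset.eq_of_subset_of_card_le (hc.trans Finset.inter_subset_right) (by omega)
      by_cases h2 : 2 ≤ (Φ ∩ Ψ).card
      · simp only [hw, hg, if_neg h, if_pos (And.intro h2 hlt)]
        nlinarith
      · simp only [hw, if_neg h]
        rw [Nat.choose_eq_zero_of_lt (by omega)]
        simpa using hg0 _
  refine step3.trans ?_
  have step4 : ∑ Φ ∈ dsets n d, g ((Φ ∩ Ψ).card) = ∑ k ∈ Finset.range (d + 1),
      (((dsets n d).filter fun Φ => (Φ ∩ Ψ).card = k).card : ℝ) * g k := by
    rw [← Finset.sum_fiberwise_of_maps_to (t := Finset.range (d + 1))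
      (g := fun Φ => (Φ ∩ Ψ).card)]
    · refine Finset.sum_congr rfl fun k _ => ?_
      rw [← nsmul_eq_mul, ← Finset.sum_const]
      refine Finset.sum_congr rfl fun Φ hΦ => ?_
      rw [(Finset.mem_filter.1 hΦ).2]
    · intro Φ _
      have : (Φ ∩ Ψ).card ≤ Ψ.card := Finset.card_le_card Finset.inter_subset_right
      rw [Finset.mem_range]; omega
  rw [step4]
  have hsub : Finset.Ico 2 d ⊆ Finset.range (d + 1) := by
    intro k hk; rw [Finset.mem_Ico] at hk; rw [Finset.mem_range]; omega
  rw [← Finset.sum_subset hsub]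
  · refine Finset.sum_le_sum fun k hk => ?_
    rw [Finset.mem_Ico] at hk
    have hc : (((dsets n d).filter fun Φ => (Φ ∩ Ψ).card = k).card : ℝ)
        ≤ (d.choose k : ℝ) * (n : ℝ) ^ (d - k) := by
      exact_mod_cast card_inter_le n d k Ψ hΨd
    refine (mul_le_mul_of_nonneg_right hc (hg0 k)).trans (le_of_eq ?_)
    simp only [hg, if_pos hk]; ring
  · intro k _ hk
    rw [Finset.mem_Ico] at hk
    simp only [hg, if_neg hk, mul_zero]

/-- The finite-`n` bound. -/
lemma finite_bound (n d : ℕ) (s p q r : ℝ) (hs0 : 0 < s) (hs1 : s ≤ 1)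
    (hp1 : p ≤ 1) (hp0 : 0 ≤ p)
    (hq0 : 0 ≤ q) (hqr : q ≤ r) (hr : 0 < r) (hr1 : r ≤ 1) :
    (∑ H ∈ (dsets n d).powerset, ∑ A ∈ (pairs n).powerset,
      joint n d s p q H A * ((cliqueEst n d A ∆ H).card : ℝ)) / (s * (n.choose d : ℝ))
    ≤ (1 - p ^ (d.choose 2)) + r ^ (d.choose 2) / s * Real.exp (∑ k ∈ Finset.Ico 2 d,
          (d.choose k : ℝ) * (s * (n : ℝ) ^ (d - k) * r⁻¹ ^ (k.choose 2))) := by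
  set X := Real.exp (∑ k ∈ Finset.Ico 2 d,
          (d.choose k : ℝ) * (s * (n : ℝ) ^ (d - k) * r⁻¹ ^ (k.choose 2))) with hX
  have hX0 : 0 < X := Real.exp_pos _
  have hpN : p ^ (d.choose 2) ≤ 1 := pow_le_one₀ hp0 hp1
  have hper : ∀ Ψ ∈ dsets n d, ∑ H ∈ (dsets n d).powerset, mu n d s H *
      ((if Ψ ∈ H then 1 else 0) + (1 - 2 * (if Ψ ∈ H then 1 else 0)) *
        ∏ e ∈ Ψ.powersetCard 2, edgeProb n p q H e)
      ≤ s * (1 - p ^ (d.choose 2)) + r ^ (d.choose 2) * X := by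
    intro Ψ hΨ
    have hΨd : Ψ.card = d := (Finset.mem_powersetCard.1 hΨ).2
    have e : ∀ H : Finset (Finset (Fin n)), mu n d s H *
      ((if Ψ ∈ H then 1 else 0) + (1 - 2 * (if Ψ ∈ H then 1 else 0)) *
        ∏ e ∈ Ψ.powersetCard 2, edgeProb n p q H e)
        = mu n d s H * (if Ψ ∈ H then 1 else 0) * (1 - p ^ (d.choose 2)) +
        mu n d s H * (if Ψ ∈ H then 0 else ∏ e ∈ Ψ.powersetCard 2, edgeProb n p q H e) := by
      intro H
      by_cases h : Ψ ∈ H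
      · have : ∏ e ∈ Ψ.powersetCard 2, edgeProb n p q H e = p ^ (d.choose 2) := by
          rw [← hΨd, ← Finset.card_powersetCard, ← Finset.prod_const]
          refine Finset.prod_congr rfl fun e he => ?_
          unfold edgeProb
          rw [if_pos]
          rw [proj, Finset.mem_filter]
          exact ⟨powersetCard_subset_pairs n Ψ he, Ψ, h, (Finset.mem_powersetCard.1 he).1⟩
        rw [this]; simp only [if_pos h]; ring
      · simp only [if_neg h]; ring
    simp_rw [e]
    rw [Finset.sum_add_distrib, ← Finset.sum_mul, sum_mu_mem n d s Ψ hΨ]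
    have := sum_false_pos_le n d s p q r hs0.le hs1 hp1 hp0 hq0 hqr hr hr1 Ψ hΨ
    linarith
  have hrhs : 0 ≤ (1 - p ^ (d.choose 2)) + r ^ (d.choose 2) / s * X := by
    have : 0 ≤ r ^ (d.choose 2) / s * X := by positivity
    linarith
  refine div_le_of_le_mul₀ (by positivity) hrhs ?_
  rw [expected_eq]
  refine (Finset.sum_le_card_nsmul _ _ _ hper).trans (le_of_eq ?_)
  have : (dsets n d).card = n.choose d := by simp [dsets]
  rw [this, nsmul_eq_mul]
  field_simp

lemma expected_nonneg (n d : ℕ) (s p q : ℝ) (hs0 : 0 ≤ s) (hs1 : s ≤ 1)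
    (hp1 : p ≤ 1) (hp0 : 0 ≤ p) (hq0 : 0 ≤ q) (hq1 : q ≤ 1) :
    0 ≤ (∑ H ∈ (dsets n d).powerset, ∑ A ∈ (pairs n).powerset,
      joint n d s p q H A * ((cliqueEst n d A ∆ H).card : ℝ)) / (s * (n.choose d : ℝ)) := by
  refine div_nonneg (Finset.sum_nonneg fun H _ => Finset.sum_nonneg fun A _ => ?_) (by positivity)
  have h1 : 0 ≤ 1 - p := by linarith
  have h2 : 0 ≤ 1 - q := by linarith
  have := mu_nonneg n d s hs0 hs1 H
  unfold joint condP
  positivity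

/-- a positive sequence with negative polynomial exponent tends to zero -/
lemma tendsto_zero_of_log (x : ℕ → ℝ) (hx : ∀ᶠ n in atTop, 0 < x n) (L : ℝ) (hL : L < 0)
    (h : Tendsto (fun n : ℕ => Real.log (x n) / Real.log n) atTop (nhds L)) :
    Tendsto x atTop (nhds 0) := by
  have hlog : Tendsto (fun n : ℕ => Real.log (n : ℝ)) atTop atTop :=
    Real.tendsto_log_atTop.comp tendsto_natCast_atTop_atTop
  have h1 : Tendsto (fun n : ℕ => Real.log (n : ℝ) * (Real.log (x n) / Real.log n)) atTop atBot :=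
    hlog.atTop_mul_neg hL h
  refine (Real.tendsto_exp_atBot.comp h1).congr' ?_
  filter_upwards [hx, hlog.eventually_gt_atTop 0] with n hn hl
  simp only [Function.comp]
  rw [mul_div_cancel₀ _ hl.ne', Real.exp_log hn]

lemma exponent_ineq (D k δ : ℝ) (hk : 2 ≤ k) (hkD : k < D)
    (hδ : δ < (D - 1) / (D + 1)) :
    (D - 1 - δ) / (D * (D - 1) / 2) * (k * (k - 1) / 2) < k - 1 - δ := by
  have hD : 0 < D * (D - 1) := mul_pos (by linarith) (by linarith)
  rw [lt_div_iff₀ (by linarith)] at hδ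
  have h1 : δ * (D + k - 1) < (k - 1) * (D - 1) := by
    rcases le_or_gt δ 0 with h | h
    · have : 0 < (k - 1) * (D - 1) := mul_pos (by linarith) (by linarith)
      nlinarith
    · have a : (D + k - 1) ≤ (k - 1) * (D + 1) := by nlinarith
      have b : δ * (D + k - 1) ≤ δ * ((k - 1) * (D + 1)) := mul_le_mul_of_nonneg_left a h.le
      nlinarith
  have h2 : 0 < (D - k) * ((k - 1) * (D - 1) - δ * (D + k - 1)) :=
    mul_pos (by linarith) (by linarith)
  rw [div_mul_eq_mul_div, div_lt_iff₀ (by linarith)]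
  nlinarith

/-- when `δ < (d−1)/(d+1)`, `β < 2δ/(d(d−1)) + (d−2)/d` and `p_n → 1`,
the clique estimator achieves almost-exact reconstruction. -/
theorem clique_estimator_almost_exact
    (d : ℕ) (hd : 2 ≤ d) (δ β : ℝ)
    (hδ : 0 ≤ δ ∧ δ < ((d : ℝ) - 1) / ((d : ℝ) + 1))
    (hβ : 0 ≤ β ∧ β < 2 * δ / ((d : ℝ) * ((d : ℝ) - 1)) + ((d : ℝ) - 2) / (d : ℝ))
    (s p q : ℕ → ℝ)
    (hs01 : ∀ n, 0 < s n ∧ s n ≤ 1)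
    (hp01 : ∀ n, 0 ≤ p n ∧ p n ≤ 1)
    (hq01 : ∀ n, 0 ≤ q n ∧ q n ≤ 1)
    (hqp : ∀ n, q n ≤ p n)
    (hs : Tendsto (fun n : ℕ => Real.log (s n) / Real.log n) atTop
      (nhds (-((d : ℝ) - 1) + δ)))
    (hq : Tendsto (fun n : ℕ => Real.log (q n) / Real.log n) atTop (nhds (-1 + β)))
    (hp : Tendsto p atTop (nhds 1)) :
    Tendsto (fun n : ℕ =>
        (∑ H ∈ (dsets n d).powerset, ∑ A ∈ (pairs n).powerset,
            joint n d (s n) (p n) (q n) H A * ((cliqueEst n d A ∆ H).card : ℝ))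
          / (s n * (n.choose d : ℝ))) atTop (nhds 0) := by
  have hD2 : (2 : ℝ) ≤ d := by exact_mod_cast hd
  set N : ℝ := (d : ℝ) * ((d : ℝ) - 1) / 2 with hN
  have hN0 : 0 < N := by
    have : 0 < (d : ℝ) * ((d : ℝ) - 1) := mul_pos (by linarith) (by linarith)
    linarith
  have hNc : ((d.choose 2 : ℕ) : ℝ) = N := Nat.cast_choose_two ℝ d
  set b : ℝ := ((d : ℝ) - 1 - δ) / N with hb
  have hb0 : 0 < b := by
    refine div_pos ?_ hN0
    have : ((d : ℝ) - 1) / ((d : ℝ) + 1) ≤ (d : ℝ) - 1 :=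
      div_le_self (by linarith) (by linarith)
    linarith [hδ.2]
  have hbβ : b < 1 - β := by
    have : 2 * δ / ((d : ℝ) * ((d : ℝ) - 1)) + ((d : ℝ) - 2) / (d : ℝ) = 1 - b := by
      have h1 : (d : ℝ) - 1 ≠ 0 := by linarith
      have h2 : (d : ℝ) ≠ 0 := by linarith
      rw [hb, hN]; field_simp; ring
    linarith [hβ.2]
  -- choose the exponent
  have hex : ∃ c : ℝ, b < c ∧ c < 1 - β ∧
      ∀ k ∈ Finset.Ico 2 d, c * ((k.choose 2 : ℕ) : ℝ) < (k : ℝ) - 1 - δ := by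
    have e1 : ∀ᶠ c in nhdsWithin b (Set.Ioi b), b < c := self_mem_nhdsWithin
    have e2 : ∀ᶠ c in nhdsWithin b (Set.Ioi b), c < 1 - β :=
      nhdsWithin_le_nhds (eventually_lt_nhds hbβ)
    have e3 : ∀ᶠ c in nhdsWithin b (Set.Ioi b),
        ∀ k ∈ Finset.Ico 2 d, c * ((k.choose 2 : ℕ) : ℝ) < (k : ℝ) - 1 - δ := by
      refine Filter.Eventually.filter_mono nhdsWithin_le_nhds ?_
      rw [Filter.eventually_all_finset]
      intro k hk
      rw [Finset.mem_Ico] at hk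
      have hlt : b * ((k.choose 2 : ℕ) : ℝ) < (k : ℝ) - 1 - δ := by
        rw [Nat.cast_choose_two]
        exact exponent_ineq d k δ (by exact_mod_cast hk.1) (by exact_mod_cast hk.2) hδ.2
      have hc : Tendsto (fun c : ℝ => c * ((k.choose 2 : ℕ) : ℝ)) (nhds b)
          (nhds (b * ((k.choose 2 : ℕ) : ℝ))) := (continuous_id.mul continuous_const).tendsto b
      exact hc.eventually_lt_const hlt
    exact (e1.and (e2.and e3)).exists
  obtain ⟨c, hbc, hcβ, hck⟩ := hex
  have hc0 : 0 < c := hb0.trans hbc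
  have hlog : Tendsto (fun n : ℕ => Real.log (n : ℝ)) atTop atTop :=
    Real.tendsto_log_atTop.comp tendsto_natCast_atTop_atTop
  have hlog0 := hlog.eventually_gt_atTop 0
  set r : ℕ → ℝ := fun n => Real.exp (-c * Real.log n) with hr
  have hr0 : ∀ n, 0 < r n := fun n => Real.exp_pos _
  have hlogr : ∀ n, Real.log (r n) = -c * Real.log n := fun n => Real.log_exp _
  have hr1 : ∀ᶠ n in atTop, r n ≤ 1 := by
    filter_upwards [hlog0] with n hn
    rw [hr, Real.exp_le_one_iff]; nlinarith
  have hqr : ∀ᶠ n in atTop, q n ≤ r n := by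
    filter_upwards [hlog0, hq.eventually_lt_const (show -1 + β < -c by linarith)] with n hn hlt
    rcases (hq01 n).1.eq_or_lt with h0 | h0
    · rw [← h0]; exact (hr0 n).le
    · rw [div_lt_iff₀ hn] at hlt
      rw [← Real.exp_log h0]
      exact Real.exp_le_exp.2 hlt.le
  -- first factor
  have hT1 : Tendsto (fun n => r n ^ (d.choose 2) / s n) atTop (nhds 0) := by
    refine tendsto_zero_of_log _ (Eventually.of_forall fun n =>
      div_pos (pow_pos (hr0 n) _) (hs01 n).1) (-c * N - (-((d : ℝ) - 1) + δ)) ?_ ?_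
    · have : b * N = (d : ℝ) - 1 - δ := div_mul_cancel₀ _ hN0.ne'
      nlinarith
    · refine (tendsto_const_nhds.sub hs).congr' ?_
      filter_upwards [hlog0] with n hn
      rw [Real.log_div (pow_pos (hr0 n) _).ne' (hs01 n).1.ne', Real.log_pow, hlogr, hNc]
      field_simp
  have hT2 : ∀ k ∈ Finset.Ico 2 d,
      Tendsto (fun n : ℕ => (d.choose k : ℝ) * (s n * (n : ℝ) ^ (d - k) * (r n)⁻¹ ^ (k.choose 2)))
        atTop (nhds 0) := by
    intro k hk
    have hk2 := hck k hk
    rw [Finset.mem_Ico] at hk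
    rw [← mul_zero (d.choose k : ℝ)]
    refine Tendsto.const_mul _ ?_
    refine tendsto_zero_of_log _ ?_ ((-((d : ℝ) - 1) + δ) +
      (((d : ℝ) - k) + c * ((k.choose 2 : ℕ) : ℝ))) ?_ ?_
    · filter_upwards [eventually_gt_atTop 0] with n hn
      have : (0 : ℝ) < n := by exact_mod_cast hn
      have := (hs01 n).1
      have := hr0 n
      positivity
    · linarith
    · refine (hs.add tendsto_const_nhds).congr' ?_
      filter_upwards [hlog0, eventually_gt_atTop 0] with n hn hn0
      have hn1 : (0 : ℝ) < n := by exact_mod_cast hn0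
      have h2 := (hs01 n).1
      have h3 := hr0 n
      rw [Real.log_mul (by positivity) (by positivity), Real.log_mul (by positivity)
        (by positivity), Real.log_pow, Real.log_pow, Real.log_inv, hlogr, Nat.cast_sub hk.2.le]
      field_simp
      ring
  have hT3 := tendsto_finsetSum (Finset.Ico 2 d) hT2
  have hT4 : Tendsto (fun n => 1 - p n ^ (d.choose 2)) atTop (nhds 0) := by
    have := (tendsto_const_nhds (x := (1 : ℝ))).sub (hp.pow (d.choose 2))
    simpa using this
  have hT5 := hT4.add (hT1.mul ((Real.continuous_exp.tendsto _).comp hT3))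
  rw [zero_mul, add_zero] at hT5
  refine tendsto_of_tendsto_of_tendsto_of_le_of_le' tendsto_const_nhds hT5 ?_ ?_
  · exact Eventually.of_forall fun n => expected_nonneg n d _ _ _ (hs01 n).1.le (hs01 n).2
      (hp01 n).2 (hp01 n).1 (hq01 n).1 (hq01 n).2
  · filter_upwards [hr1, hqr] with n h1 h2
    exact finite_bound n d (s n) (p n) (q n) (r n) (hs01 n).1 (hs01 n).2 (hp01 n).2 (hp01 n).1
      (hq01 n).1 h2 (hr0 n) h1

end NoisyHypergraph
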